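/- Fix a nonnegative integer d and complex parameters σ, σ*, ρ with ρ ≠ 0 and σσ* ≠ ρ. Then for all integers 0 ≤ x ≤ d and 0 ≤ i ≤ d, the following contiguity relation for the normalized Krawtchouk functions holds: (σσ*/(ρ − σσ*)) · (x − d − 1) · p_{x,i}(d; σ, σ*, ρ) = (d + 1 − i) · p_{x,i}(d+1; σ, σ*, ρ) + (i + 1) · p_{x,i+1}(d+1; σ, σ*, ρ). -/

import Mathlib

/-- Pochhammer symbol `(a)_k = a (a+1) ⋯ (a+k-1)`. -/
noncomputable def poch (a : ℂ) (k : ℕ) : ℂ := ∏ l ∈ Finset.range k, (a + l)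

/-- Normalized Krawtchouk function `p_{x,i}(d; σ, σ*, ρ)`, with the convention that it
vanishes for negative `i`. -/
noncomputable def krawP (d : ℕ) (σ σs ρ : ℂ) (x : ℕ) (i : ℤ) : ℂ :=
  if i < 0 then 0
  else
    (ρ / (σ * σs - ρ)) ^ i.toNat * (d.choose i.toNat : ℂ) *
      ∑ k ∈ Finset.range (min i.toNat x + 1),
        poch (-(i.toNat : ℂ)) k * poch (-(x : ℂ)) k /
          (poch (-(d : ℂ)) k * (k.factorial : ℂ)) * (σ * σs / ρ) ^ k

theorem poch_zero (a : ℂ) : poch a 0 = 1 := by simp [poch]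

theorem poch_succ (a : ℂ) (k : ℕ) : poch a (k + 1) = poch a k * (a + k) := by
  simp [poch, Finset.prod_range_succ]

theorem poch_succ_left (a : ℂ) (k : ℕ) : poch a (k + 1) = a * poch (a + 1) k := by
  rw [poch, poch, Finset.prod_range_succ', mul_comm]
  congr 1
  · simp
  · refine Finset.prod_congr rfl fun l _ => ?_
    push_cast
    ring

theorem poch_neg_natCast_eq_zero {n k : ℕ} (h : n < k) : poch (-(n : ℂ)) k = 0 :=
  Finset.prod_eq_zero (Finset.mem_range.2 h) (by simp)

theorem poch_neg_natCast_ne_zero {n k : ℕ} (h : k ≤ n) : poch (-(n : ℂ)) k ≠ 0 := by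
  refine Finset.prod_ne_zero_iff.2 fun l hl h0 => ?_
  have hln : (l : ℂ) = n := by linear_combination h0
  have hlt := Finset.mem_range.1 hl
  have : l = n := by exact_mod_cast hln
  omega

/-- Coefficient of `u ^ k` in the hypergeometric sum of `krawP`. -/
noncomputable def krawCoeff (d x i k : ℕ) : ℂ :=
  poch (-(i : ℂ)) k * poch (-(x : ℂ)) k / (poch (-(d : ℂ)) k * (k.factorial : ℂ))

theorem krawP_natCast (d : ℕ) (σ σs ρ : ℂ) (x i : ℕ) {N : ℕ} (hN : i < N) :
    krawP d σ σs ρ x (i : ℤ) = (ρ / (σ * σs - ρ)) ^ i * (d.choose i : ℂ) *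
      ∑ k ∈ Finset.range N, krawCoeff d x i k * (σ * σs / ρ) ^ k := by
  rw [krawP, if_neg (by omega), Int.toNat_natCast]
  congr 1
  refine Finset.sum_subset (Finset.range_mono (by omega)) fun k _ hk => ?_
  rw [Finset.mem_range, not_lt] at hk
  rcases (by omega : i < k ∨ x < k) with h | h <;>
    simp [poch_neg_natCast_eq_zero h]

theorem krawCoeff_contiguity (d x i k : ℕ) (hk : k ≤ d) :
    ((d : ℂ) + 1 - x) * krawCoeff d x i k - (d + 1) * krawCoeff (d + 1) x i k =
      (d + 1) * (krawCoeff (d + 1) x (i + 1) (k + 1) - krawCoeff (d + 1) x i (k + 1)) := by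
  have hd : poch (-(d : ℂ)) k ≠ 0 := poch_neg_natCast_ne_zero hk
  have hd' : poch (-((d + 1 : ℕ) : ℂ)) k ≠ 0 := poch_neg_natCast_ne_zero (by omega)
  have hf : (k.factorial : ℂ) ≠ 0 := by exact_mod_cast k.factorial_ne_zero
  have hk1 : (k : ℂ) + 1 ≠ 0 := by exact_mod_cast k.succ_ne_zero
  have hd1 : (d : ℂ) + 1 ≠ 0 := by exact_mod_cast d.succ_ne_zero
  have shift (n : ℕ) :
      poch (-((n + 1 : ℕ) : ℂ)) (k + 1) = -((n : ℂ) + 1) * poch (-(n : ℂ)) k := by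
    rw [poch_succ_left]
    push_cast
    congr 2
    ring
  have hrel : poch (-((d + 1 : ℕ) : ℂ)) k * ((d : ℂ) + 1 - k) =
      ((d : ℂ) + 1) * poch (-(d : ℂ)) k := by
    have h := poch_succ (-((d + 1 : ℕ) : ℂ)) k
    rw [shift] at h
    push_cast at h ⊢
    linear_combination h
  have hinv : ((d : ℂ) + 1) / poch (-((d + 1 : ℕ) : ℂ)) k =
      ((d : ℂ) + 1 - k) / poch (-(d : ℂ)) k := by
    rw [div_eq_div_iff hd' hd]
    linear_combination -hrel
  have hcoeff : ((d : ℂ) + 1) * krawCoeff (d + 1) x i k =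
      ((d : ℂ) + 1 - k) * krawCoeff d x i k := by
    calc _ = poch (-(i : ℂ)) k * poch (-(x : ℂ)) k / (k.factorial : ℂ) *
          (((d : ℂ) + 1) / poch (-((d + 1 : ℕ) : ℂ)) k) := by
          rw [krawCoeff]; field_simp
      _ = _ := by rw [hinv, krawCoeff]; field_simp
  rw [hcoeff]
  simp only [krawCoeff, shift, Nat.factorial_succ, poch_succ (-(i : ℂ)), poch_succ (-(x : ℂ))]
  push_cast
  field_simp
  ring

theorem sum_krawCoeff_contiguity (d x i : ℕ) (hi : i ≤ d) (u : ℂ) :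
    u * ((d : ℂ) + 1 - x) * ∑ k ∈ Finset.range (i + 1), krawCoeff d x i k * u ^ k =
      (d + 1) * ((u - 1) * ∑ k ∈ Finset.range (i + 1), krawCoeff (d + 1) x i k * u ^ k +
        ∑ k ∈ Finset.range (i + 2), krawCoeff (d + 1) x (i + 1) k * u ^ k) := by
  have hlast : krawCoeff (d + 1) x i (i + 1) = 0 := by
    simp [krawCoeff, poch_neg_natCast_eq_zero (Nat.lt_succ_self i)]
  have hext : ∑ k ∈ Finset.range (i + 1), krawCoeff (d + 1) x i k * u ^ k =
      ∑ k ∈ Finset.range (i + 1), krawCoeff (d + 1) x i (k + 1) * u ^ (k + 1) + 1 := by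
    have h := Finset.sum_range_succ (fun k => krawCoeff (d + 1) x i k * u ^ k) (i + 1)
    rw [Finset.sum_range_succ', hlast] at h
    simpa [krawCoeff, poch_zero] using h.symm
  have htop : ∑ k ∈ Finset.range (i + 2), krawCoeff (d + 1) x (i + 1) k * u ^ k =
      ∑ k ∈ Finset.range (i + 1), krawCoeff (d + 1) x (i + 1) (k + 1) * u ^ (k + 1) + 1 := by
    rw [Finset.sum_range_succ']
    simp [krawCoeff, poch_zero]
  have key : u * ((d : ℂ) + 1 - x) * ∑ k ∈ Finset.range (i + 1), krawCoeff d x i k * u ^ k -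
      u * (d + 1) * ∑ k ∈ Finset.range (i + 1), krawCoeff (d + 1) x i k * u ^ k =
      (d + 1) * (∑ k ∈ Finset.range (i + 1), krawCoeff (d + 1) x (i + 1) (k + 1) * u ^ (k + 1) -
        ∑ k ∈ Finset.range (i + 1), krawCoeff (d + 1) x i (k + 1) * u ^ (k + 1)) := by
    simp only [Finset.mul_sum, ← Finset.sum_sub_distrib]
    refine Finset.sum_congr rfl fun k hk => ?_
    have hkd : k ≤ d := by
      have := Finset.mem_range.1 hk
      omega
    linear_combination u ^ (k + 1) * krawCoeff_contiguity d x i k hkd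
  rw [htop]
  linear_combination key + ((d : ℂ) + 1) * hext

theorem kraw_contiguity_raise (d : ℕ) (σ σs ρ : ℂ)
    (hρ : ρ ≠ 0) (hσσs : σ * σs ≠ ρ)
    (x i : ℕ) (hx : x ≤ d) (hi : i ≤ d) :
    σ * σs / (ρ - σ * σs) * ((x : ℂ) - d - 1) * krawP d σ σs ρ x (i : ℤ) =
      ((d : ℂ) + 1 - i) * krawP (d + 1) σ σs ρ x (i : ℤ) +
        ((i : ℂ) + 1) * krawP (d + 1) σ σs ρ x ((i : ℤ) + 1) := by
  have hsub : σ * σs - ρ ≠ 0 := sub_ne_zero.2 hσσs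
  have hsub' : ρ - σ * σs ≠ 0 := sub_ne_zero.2 hσσs.symm
  have hchoose : ((d : ℂ) + 1 - i) * ((d + 1).choose i : ℂ) = (d + 1) * (d.choose i : ℂ) := by
    have h := Nat.choose_mul_succ_eq d i
    rw [← Nat.cast_inj (R := ℂ)] at h
    push_cast [Nat.cast_sub (show i ≤ d + 1 by omega)] at h
    linear_combination -h
  have hchoose_succ : ((i : ℂ) + 1) * ((d + 1).choose (i + 1) : ℂ) =
      (d + 1) * (d.choose i : ℂ) := by
    have h := Nat.add_one_mul_choose_eq d i
    rw [← Nat.cast_inj (R := ℂ)] at h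
    push_cast at h
    linear_combination -h
  have hsum := sum_krawCoeff_contiguity d x i hi (σ * σs / ρ)
  rw [show (i : ℤ) + 1 = ((i + 1 : ℕ) : ℤ) by push_cast; rfl,
    krawP_natCast d σ σs ρ x i (Nat.lt_succ_self i),
    krawP_natCast (d + 1) σ σs ρ x i (Nat.lt_succ_self i),
    krawP_natCast (d + 1) σ σs ρ x (i + 1) (Nat.lt_succ_self (i + 1))]
  generalize ∑ k ∈ Finset.range (i + 1), krawCoeff d x i k * (σ * σs / ρ) ^ k = A at *
  generalize ∑ k ∈ Finset.range (i + 1), krawCoeff (d + 1) x i k * (σ * σs / ρ) ^ k = B at *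
  generalize ∑ k ∈ Finset.range (i + 2),
    krawCoeff (d + 1) x (i + 1) k * (σ * σs / ρ) ^ k = C at *
  have hfactor : σ * σs / (ρ - σ * σs) = -(ρ / (σ * σs - ρ)) * (σ * σs / ρ) := by
    field_simp
    ring
  have hone : ρ / (σ * σs - ρ) * (σ * σs / ρ - 1) = 1 := by
    field_simp
  rw [hfactor, pow_succ]
  generalize ρ / (σ * σs - ρ) = t at *
  generalize σ * σs / ρ = u at *
  linear_combination t ^ (i + 1) * (d.choose i : ℂ) * hsum - t ^ i * B * hchoose -
    t ^ (i + 1) * C * hchoose_succ + t ^ i * (d.choose i : ℂ) * (d + 1) * B * hone
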